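/- arXiv:1208.0974 — 2 statements merged into one kernel-verified Lean document; each statement's English description precedes it below -/
import Mathlib

section
/- Let (R, |·|) be a normed unique factorization domain with fraction field K, let S ⊆ R \ {0} be a saturated multiplicatively closed subset containing 1, and let R_S = S⁻¹R ⊆ K be the localization. Let |·|_S be a norm on R_S satisfying |s|_S = 1 for all s ∈ S and |x|_S = |x| for every x ∈ R all of whose divisors lying in S are units. Let q be a quadratic form in n variables over R and let E > 0 be a real number such that for all x ∈ Kⁿ there exists y ∈ Rⁿ with |q(x − y)| ≤ E. Then for all x ∈ Kⁿ there exists y_S ∈ R_Sⁿ with |q(x − y_S)|_S ≤ E. -/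
open scoped BigOperators

/-- Evaluation of the quadratic form with coefficient matrix `M`, after mapping
the coefficients through the ring homomorphism `φ`. -/
def quadEval {R S : Type*} [CommRing R] [CommRing S] (φ : R →+* S) {n : ℕ}
    (M : Matrix (Fin n) (Fin n) R) (x : Fin n → S) : S :=
  ∑ i, ∑ j, φ (M i j) * x i * x j

/-- `f : R → ℕ` is a norm on the integral domain `R`. -/
def IsNorm {R : Type*} [CommRing R] [IsDomain R] (f : R → ℕ) : Prop :=
  (∀ x, f x = 0 ↔ x = 0) ∧ (∀ x y, f (x * y) = f x * f y) ∧
    (∀ x, f x = 1 ↔ IsUnit x)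

/-- `N : K → ℚ` is the extension of the norm `f : R → ℕ` to the fraction field
`K`, given by `|a/b| = |a|/|b|`. -/
def IsNormExt {R K : Type*} [CommRing R] [IsDomain R] [Field K] [Algebra R K]
    (f : R → ℕ) (N : K → ℚ) : Prop :=
  ∀ a b : R, b ≠ 0 →
    N (algebraMap R K a / algebraMap R K b) = (f a : ℚ) / (f b : ℚ)

theorem exists_split {R : Type*} [CommRing R] [IsDomain R] [UniqueFactorizationMonoid R]
    (S : Submonoid R) (hSsat : ∀ x y : R, x ∣ y → y ∈ S → x ∈ S) (x : R) (hx : x ≠ 0) :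
    ∃ s c : R, s ∈ S ∧ (∀ u : R, u ∈ S → u ∣ c → IsUnit u) ∧ x = s * c := by
  induction x using UniqueFactorizationMonoid.induction_on_prime with
  | h₁ => exact absurd rfl hx
  | h₂ x hu =>
    exact ⟨1, x, S.one_mem, fun u _ hd => isUnit_of_dvd_unit hd hu, (one_mul x).symm⟩
  | h₃ a p ha hp ih =>
    obtain ⟨s, c, hs, hc, rfl⟩ := ih ha
    by_cases hpS : p ∈ S
    · exact ⟨p * s, c, S.mul_mem hpS hs, hc, by ring⟩
    · refine ⟨s, p * c, hs, ?_, by ring⟩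
      rintro u hu ⟨v, hv⟩
      have hpu : ¬ p ∣ u := fun h => hpS (hSsat p u h hu)
      obtain ⟨w, rfl⟩ := (hp.dvd_or_dvd (⟨c, hv.symm⟩ : p ∣ u * v)).resolve_left hpu
      refine hc u hu ⟨w, mul_left_cancel₀ hp.ne_zero ?_⟩
      rw [hv]; ring

theorem quadEval_div {R K : Type*} [CommRing R] [Field K] (φ : R →+* K) {n : ℕ}
    (M : Matrix (Fin n) (Fin n) R) (b : Fin n → R) (D : R) :
    quadEval φ M (fun i => φ (b i) / φ D)
      = φ (quadEval (RingHom.id R) M b) / φ (D ^ 2) := by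
  unfold quadEval
  simp only [map_sum, map_mul, map_pow, RingHom.id_apply, Finset.sum_div]
  refine Finset.sum_congr rfl fun i _ => Finset.sum_congr rfl fun j _ => ?_
  ring

/-- **Euclideanity bounds localize.**  Let `(R, |·|)` be a normed UFD with
fraction field `K`, `S` a saturated multiplicatively closed subset of
`R \ {0}` containing `1`, and `A = S⁻¹R` the localization, equipped with a
norm `|·|_S` satisfying `|s|_S = 1` for `s ∈ S` and `|x|_S = |x|` for `x ∈ R`
prime to `S`.  If `E > 0` is such that every `x ∈ Kⁿ` admits `y ∈ Rⁿ` with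
`|q(x - y)| ≤ E`, then every `x ∈ Kⁿ` admits `y_S ∈ Aⁿ` with
`|q(x - y_S)|_S ≤ E`. -/
theorem euclideanity_localizes {R K A : Type*} [CommRing R] [IsDomain R]
    [UniqueFactorizationMonoid R] [Field K] [Algebra R K] [IsFractionRing R K]
    (f : R → ℕ) (hf : IsNorm f) (N : K → ℚ) (hN : IsNormExt f N)
    (S : Submonoid R) (hS0 : (0 : R) ∉ S)
    (hSsat : ∀ x y : R, x ∣ y → y ∈ S → x ∈ S)
    [CommRing A] [IsDomain A] [Algebra R A] [IsLocalization S A]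
    [Algebra A K] [IsScalarTower R A K] [IsFractionRing A K]
    (fS : A → ℕ) (hfS : IsNorm fS) (NS : K → ℚ) (hNS : IsNormExt fS NS)
    (hfS_one : ∀ s ∈ S, fS (algebraMap R A s) = 1)
    (hfS_eq : ∀ x : R, (∀ s : R, s ∈ S → s ∣ x → IsUnit s) →
      fS (algebraMap R A x) = f x)
    {n : ℕ} (M : Matrix (Fin n) (Fin n) R) (E : ℝ) (hE : 0 < E)
    (hq : ∀ x : Fin n → K, ∃ y : Fin n → R,
      (N (quadEval (algebraMap R K) M (x - fun i => algebraMap R K (y i))) : ℝ)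
        ≤ E) :
    ∀ x : Fin n → K, ∃ yS : Fin n → A,
      (NS (quadEval (algebraMap R K) M (x - fun i => algebraMap A K (yS i))) : ℝ)
        ≤ E := by
  classical
  have hAK : ∀ r : R, algebraMap A K (algebraMap R A r) = algebraMap R K r :=
    fun r => (IsScalarTower.algebraMap_apply R A K r).symm
  have hinj : Function.Injective (algebraMap R K) := IsFractionRing.injective R K
  have hle : ∀ c : R, fS (algebraMap R A c) ≤ f c := by
    intro c
    by_cases hc : c = 0
    · subst hc
      rw [map_zero, (hfS.1 0).2 rfl]
      exact Nat.zero_le _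
    · obtain ⟨s, c', hs, hc', rfl⟩ := exists_split S hSsat c hc
      have hs0 : s ≠ 0 := fun h => hS0 (h ▸ hs)
      have hfs : f s ≠ 0 := fun h => hs0 ((hf.1 s).1 h)
      rw [map_mul, hfS.2.1, hfS_one s hs, hfS_eq c' hc', hf.2.1]
      exact Nat.mul_le_mul_right _ (Nat.one_le_iff_ne_zero.2 hfs)
  intro x
  obtain ⟨D, hD⟩ := IsLocalization.exist_integer_multiples_of_finite (nonZeroDivisors R) x
  choose a ha using hD
  have hD0 : (D : R) ≠ 0 := nonZeroDivisors.coe_ne_zero D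
  obtain ⟨s, d, hs, hd, hsd⟩ := exists_split S hSsat (D : R) hD0
  have hs0 : s ≠ 0 := fun h => hS0 (h ▸ hs)
  have hd0 : d ≠ 0 := by
    rintro rfl
    exact hD0 (by rw [hsd, mul_zero])
  have hsK : algebraMap R K s ≠ 0 := fun h => hs0 (hinj (by rw [h, map_zero]))
  have hdK : algebraMap R K d ≠ 0 := fun h => hd0 (hinj (by rw [h, map_zero]))
  have hx : ∀ i, algebraMap R K (a i) = algebraMap R K s * algebraMap R K d * x i := by
    intro i
    rw [ha i, Algebra.smul_def, hsd, map_mul]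
  obtain ⟨y, hy⟩ := hq (fun i => algebraMap R K s * x i)
  refine ⟨fun i => IsLocalization.mk' A (y i) (⟨s, hs⟩ : S), ?_⟩
  have hyS : ∀ i, algebraMap A K (IsLocalization.mk' A (y i) (⟨s, hs⟩ : S))
      = algebraMap R K (y i) / algebraMap R K s := by
    intro i
    rw [eq_div_iff hsK, ← hAK s, ← hAK (y i), ← map_mul]
    congr 1
    exact IsLocalization.mk'_spec A (y i) (⟨s, hs⟩ : S)
  have e1 : ((fun i => algebraMap R K s * x i) - fun i => algebraMap R K (y i))
      = fun i => algebraMap R K (a i - d * y i) / algebraMap R K d := by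
    funext i
    simp only [Pi.sub_apply, map_sub, map_mul, hx]
    field_simp
  have e2 : (x - fun i => algebraMap A K (IsLocalization.mk' A (y i) (⟨s, hs⟩ : S)))
      = fun i => algebraMap R K (a i - d * y i) / algebraMap R K (s * d) := by
    funext i
    simp only [Pi.sub_apply, map_sub, map_mul, hx, hyS]
    field_simp
  rw [e1, quadEval_div, hN _ _ (pow_ne_zero 2 hd0)] at hy
  have hsdA : algebraMap R A ((s * d) ^ 2) ≠ 0 := by
    intro h
    have h2 := hAK ((s * d) ^ 2)
    rw [h, map_zero] at h2
    exact pow_ne_zero 2 (mul_ne_zero hs0 hd0) (hinj (by rw [← h2, map_zero]))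
  rw [e2, quadEval_div, ← hAK, ← hAK ((s * d) ^ 2), hNS _ _ hsdA]
  have hden : fS (algebraMap R A ((s * d) ^ 2)) = f (d ^ 2) := by
    simp only [pow_two, map_mul, hfS.2.1, hf.2.1, hfS_one s hs, hfS_eq d hd, one_mul]
  rw [hden]
  refine le_trans ?_ hy
  have := hle (quadEval (RingHom.id R) M fun i => a i - d * y i)
  norm_cast
  gcongr
end

section
/- Let R be a Dedekind domain with fraction field K of characteristic not 2, let v be a height-one prime (i.e., nonzero maximal ideal) of R, let K_v be the v-adic completion of K and R_v ⊆ K_v its ring of integers (the v-adic completion of the localization of R at v). If a quadratic form q in n variables over R is an ADC form over R, then its base extension to R_v is an ADC form: for every nonzero D ∈ R_v, if there exists X ∈ K_vⁿ with q(X) = D, then there exists Y ∈ R_vⁿ with q(Y) = D. -/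
open scoped BigOperators

open IsDedekindDomain

/-- A quadratic form over `R` is an ADC form if every `d ∈ R` represented by
the form over the fraction field `K` is represented over `R`. -/
def IsADCForm {R : Type*} (K : Type*) [CommRing R] [Field K] [Algebra R K]
    {n : ℕ} (M : Matrix (Fin n) (Fin n) R) : Prop :=
  ∀ d : R, (∃ x : Fin n → K, quadEval (algebraMap R K) M x = algebraMap R K d) →
    ∃ y : Fin n → R, quadEval (RingHom.id R) M y = d

open Topology Filter in
theorem sq_mem_nhds_one_aux {L : Type*} [NontriviallyNormedField L] [CompleteSpace L]
    (h : (2 : L) ≠ 0) : {y : L | ∃ u : L, u ^ 2 = y} ∈ 𝓝 (1 : L) := by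
  have hd : HasStrictDerivAt (fun u : L => u ^ 2) (2 : L) 1 := by
    simpa using hasStrictDerivAt_pow 2 (1 : L)
  have hm := hd.map_nhds_eq h
  rw [one_pow] at hm
  rw [← hm]
  exact Filter.mem_map.2 (Filter.Eventually.of_forall fun u => ⟨u, rfl⟩)

open Topology Filter in
theorem sq_mem_nhds_one {R K : Type*} [CommRing R]
    [IsDedekindDomain R] [Field K] [Algebra R K] [IsFractionRing R K]
    (v : HeightOneSpectrum R) (h : (2 : v.adicCompletion K) ≠ 0) :
    {y : v.adicCompletion K | ∃ u, u ^ 2 = y} ∈ 𝓝 (1 : v.adicCompletion K) := by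
  obtain ⟨π, hπ⟩ := v.valuation_exists_uniformizer K
  have hex : ∃ x : v.adicCompletion K, x ≠ 0 ∧
      (Valued.v : Valuation (v.adicCompletion K) (WithZero (Multiplicative ℤ))) x ≠ 1 := by
    have h1 : (Valued.v : Valuation (v.adicCompletion K) (WithZero (Multiplicative ℤ)))
      (algebraMap K (v.adicCompletion K) π) = _ := v.valuedAdicCompletion_eq_valuation' π
    rw [hπ] at h1
    refine ⟨algebraMap K (v.adicCompletion K) π, ?_, ?_⟩
    · intro h0
      rw [h0] at h1
      rw [map_zero] at h1
      exact WithZero.exp_ne_zero h1.symm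
    · rw [h1]
      decide
  letI : Valuation.RankLeOne
      (Valued.v : Valuation (v.adicCompletion K) (WithZero (Multiplicative ℤ))) :=
    { hom' := (WithZeroMulInt.toNNReal (e := 2) two_ne_zero).comp
        MonoidWithZeroHom.ValueGroup₀.embedding
      strictMono' := (WithZeroMulInt.toNNReal_strictMono one_lt_two).comp
        MonoidWithZeroHom.ValueGroup₀.embedding_strictMono }
  letI := Valuation.RankLeOne.rankOne_of_exists _ hex
  letI := Valued.toNontriviallyNormedField (v.adicCompletion K) (WithZero (Multiplicative ℤ))
  exact sq_mem_nhds_one_aux h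

theorem quadEval_smul {R S : Type*} [CommRing R] [CommRing S] (φ : R →+* S) {n : ℕ}
    (M : Matrix (Fin n) (Fin n) R) (c : S) (x : Fin n → S) :
    quadEval φ M (fun i => c * x i) = c ^ 2 * quadEval φ M x := by
  simp only [quadEval, Finset.mul_sum]
  refine Finset.sum_congr rfl fun i _ => Finset.sum_congr rfl fun j _ => by ring

theorem quadEval_comp {R S T : Type*} [CommRing R] [CommRing S] [CommRing T]
    (φ : R →+* S) (ψ : S →+* T) {n : ℕ}
    (M : Matrix (Fin n) (Fin n) R) (x : Fin n → S) :
    quadEval (ψ.comp φ) M (fun i => ψ (x i)) = ψ (quadEval φ M x) := by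
  simp [quadEval, map_sum]

/-- **The ADC property passes to completions.**  Let `R` be a Dedekind domain
with fraction field `K` of characteristic not `2` and `v` a height-one prime of
`R`, with `v`-adic completion `K_v` and ring of integers `R_v`.  If a quadratic
form `q` over `R` is ADC, then its base extension to `R_v` is ADC: every
nonzero `D ∈ R_v` represented by `q` over `K_v` is represented over `R_v`. -/
theorem ADC_completion {R K : Type*} [CommRing R] [IsDomain R]
    [IsDedekindDomain R] [Field K] [Algebra R K] [IsFractionRing R K]
    (h2 : ringChar K ≠ 2) (v : HeightOneSpectrum R)
    {n : ℕ} (M : Matrix (Fin n) (Fin n) R) (hADC : IsADCForm K M) :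
    ∀ D : v.adicCompletionIntegers K, D ≠ 0 →
      (∃ X : Fin n → v.adicCompletion K,
        quadEval ((algebraMap K (v.adicCompletion K)).comp (algebraMap R K)) M X
          = (D : v.adicCompletion K)) →
      ∃ Y : Fin n → v.adicCompletionIntegers K,
        quadEval ((algebraMap K (v.adicCompletion K)).comp (algebraMap R K)) M
          (fun i => (Y i : v.adicCompletion K)) = (D : v.adicCompletion K) := by
  intro D hD ⟨X, hX⟩
  have hD' : (D : v.adicCompletion K) ≠ 0 := by simpa using hD
  have h2K : (2 : K) ≠ 0 := Ring.two_ne_zero h2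
  have h2v : (2 : v.adicCompletion K) ≠ 0 := by
    have := (map_ne_zero (algebraMap K (v.adicCompletion K))).2 h2K
    rwa [map_ofNat] at this
  set ι := algebraMap K (v.adicCompletion K) with hι
  have hcont : Continuous fun x : Fin n → v.adicCompletion K =>
      quadEval (ι.comp (algebraMap R K)) M x := by
    unfold quadEval
    fun_prop
  have hca : ContinuousAt (fun x : Fin n → v.adicCompletion K =>
      (D : v.adicCompletion K) / quadEval (ι.comp (algebraMap R K)) M x) X :=
    continuousAt_const.div hcont.continuousAt (by rw [hX]; exact hD')
  have hmem := hca.preimage_mem_nhds (t := {y | ∃ u, u ^ 2 = y}) (by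
    rw [hX, div_self hD']
    exact sq_mem_nhds_one v h2v)
  have hval := hcont.continuousAt.preimage_mem_nhds (x := X)
    (t := {y | Valued.v y = Valued.v (D : v.adicCompletion K)}) (by
      rw [hX]
      exact Valued.locally_const (by simpa using hD'))
  have hdense : DenseRange (Pi.map fun _ : Fin n => (ι : K → v.adicCompletion K)) :=
    DenseRange.piMap fun _ => v.denseRange_algebraMap K
  obtain ⟨_, ⟨⟨u, hu⟩, hv⟩, ⟨x, rfl⟩⟩ :=
    mem_closure_iff_nhds.1 (hdense X) _ (Filter.inter_mem hmem hval)
  have hq : quadEval (ι.comp (algebraMap R K)) M (Pi.map (fun _ : Fin n => (ι : K → _)) x)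
      = ι (quadEval (algebraMap R K) M x) := quadEval_comp _ _ _ _
  simp only [Set.mem_preimage, Set.mem_ofPred_eq] at hv
  change Valued.v _ = Valued.v _ at hv
  change u ^ 2 = _ / _ at hu
  rw [hq] at hu hv
  set d := quadEval (algebraMap R K) M x with hd
  have hvD : Valued.v (D : v.adicCompletion K) ≤ 1 :=
    (HeightOneSpectrum.mem_adicCompletionIntegers R K v).1 D.2
  have hvd : Valued.v (ι d) = v.valuation K d := v.valuedAdicCompletion_eq_valuation' d
  have hd0 : ι d ≠ 0 := by
    intro h0
    rw [h0, map_zero] at hv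
    exact hD' (by simpa using hv.symm)
  obtain ⟨a, s, has⟩ := v.exists_primeCompl_mul_eq_of_integer d (by rw [← hvd, hv]; exact hvD)
  have hsv : v.valuation K (algebraMap R K s) = 1 := by
    rw [HeightOneSpectrum.valuation_of_algebraMap]
    exact (v.intValuation_eq_one_iff_mem_primeCompl s).2 s.2
  have hs0 : algebraMap R K s ≠ 0 := by
    intro h0
    rw [h0, map_zero] at hsv
    exact zero_ne_one hsv
  obtain ⟨y, hy⟩ := hADC (s * a) ⟨fun i => algebraMap R K s * x i, by
    rw [quadEval_smul, ← hd, map_mul, ← has]; ring⟩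
  have hy' : quadEval (algebraMap R K) M (fun i => algebraMap R K (y i))
      = algebraMap R K s ^ 2 * d := by
    have := quadEval_comp (RingHom.id R) (algebraMap R K) M y
    rw [hy, RingHom.comp_id] at this
    rw [this, map_mul, ← has]; ring
  have hvs : Valued.v (ι (algebraMap R K s)) = 1 := by
    rw [← hsv]; exact v.valuedAdicCompletion_eq_valuation' _
  have hvu : Valued.v u = 1 := by
    have : Valued.v (u ^ 2) = 1 := by
      rw [hu, map_div₀, hv, div_self]
      simpa using hD'
    rw [map_pow] at this
    exact (pow_eq_one_iff_of_nonneg zero_le' two_ne_zero).1 this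
  have hιs : ι (algebraMap R K s) ≠ 0 := by simpa using hs0
  refine ⟨fun i => ⟨u * (ι (algebraMap R K s))⁻¹ * ι (algebraMap R K (y i)), ?_⟩, ?_⟩
  · rw [HeightOneSpectrum.mem_adicCompletionIntegers, map_mul, map_mul, map_inv₀, hvu, hvs,
      inv_one, one_mul, one_mul]
    refine le_of_eq_of_le (v.valuedAdicCompletion_eq_valuation' _) (v.valuation_le_one _)
  · change quadEval _ M (fun i => u * (ι (algebraMap R K s))⁻¹ * ι (algebraMap R K (y i))) = _
    rw [quadEval_smul, quadEval_comp, hy', map_mul, map_pow, mul_pow, hu]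
    field_simp
end
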